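/- In the equal-coupling case Γ_{jl} ≡ Γ > 0 (j ≠ l) with weak dissipation Λ_j = θΛ^{(1)}_j, the growth-rate difference satisfies μ - 2λ = -(2θ²/(N²(N+1)Γ)) ∑_{j=0}^{N-1} (Λ^{(1)}_j - λ^{(1)})² + O(θ³), where λ^{(1)} = (1/N)∑_j Λ^{(1)}_j. In particular, μ - 2λ < 0 for small θ as soon as the Λ^{(1)}_j are not all equal. -/

import Mathlib

open Matrix Finset

/-- The second-moment coupling operator `Θ` acting on symmetric arrays. -/
def Theta {N : ℕ} (Γ : Matrix (Fin N) (Fin N) ℝ) (S : Fin N → Fin N → ℝ) :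
    Fin N → Fin N → ℝ :=
  fun j l =>
    (if j ≠ l then 2 * Γ j l * (S j j + S l l - 2 * S j l) else 0)
      + ∑ n ∈ (Finset.univ.erase j).erase l,
          (Γ l n * (S j n - S j l) + Γ j n * (S n l - S j l))

/-- The diagonal dissipation operator `(Ψ S)_{jl} = (Λ_j + Λ_l) S_{jl}`. -/
def Psi {N : ℕ} (Λ : Fin N → ℝ) (S : Fin N → Fin N → ℝ) : Fin N → Fin N → ℝ :=
  fun j l => (Λ j + Λ l) * S j l

/-- A real eigenvalue of a linear map with nonnegative off-diagonal coefficients is bounded by any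
`c` such that `T w ≤ c w` for some positive `w`. -/
theorem eigenvalue_le_of_supersolution {ι : Type*} [Fintype ι]
    (T : (ι → ℝ) →ₗ[ℝ] (ι → ℝ))
    (hT : ∀ (i : ι) (y : ι → ℝ), (∀ j, 0 ≤ y j) → y i = 0 → 0 ≤ T y i)
    {w : ι → ℝ} (hw : ∀ i, 0 < w i) {c : ℝ} (hc : ∀ i, T w i ≤ c * w i)
    {x : ι → ℝ} (hx : x ≠ 0) {ν : ℝ} (hν : ∀ i, T x i = ν * x i) : ν ≤ c := by
  obtain ⟨k, hk⟩ := Function.ne_iff.mp hx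
  obtain ⟨i, -, hi⟩ := Finset.exists_max_image univ (fun i => |x i| / w i) ⟨k, mem_univ k⟩
  have main : ∀ x : ι → ℝ, (∀ i, T x i = ν * x i) → 0 < x i →
      (∀ j, x j / w j ≤ x i / w i) → ν ≤ c := by
    intro x hν hpos hmax
    have h := hT i ((x i / w i) • w - x)
      (fun j => by
        have := (div_le_iff₀ (hw j)).mp (hmax j)
        simpa using this)
      (by simp [(hw i).ne'])
    simp only [map_sub, map_smul, Pi.sub_apply, Pi.smul_apply, smul_eq_mul, hν] at h
    have h2 : x i / w i * T w i ≤ x i / w i * (c * w i) :=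
      mul_le_mul_of_nonneg_left (hc i) (div_pos hpos (hw i)).le
    have h3 : x i / w i * (c * w i) = c * x i := by
      have := (hw i).ne'
      field_simp
    exact le_of_mul_le_mul_right (by linarith) hpos
  have habs : 0 < |x i| := by
    have h1 : 0 < |x k| / w k := div_pos (abs_pos.mpr hk) (hw k)
    have h2 := h1.trans_le (hi k (mem_univ k))
    exact (div_pos_iff_of_pos_right (hw i)).mp h2
  have hle : ∀ j, |x j| / w j ≤ |x i| / w i := fun j => hi j (mem_univ j)
  rcases abs_cases (x i) with ⟨h, -⟩ | ⟨h, -⟩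
  · refine main x hν (h ▸ habs) fun j => ?_
    rw [← h]
    exact (div_le_div_of_nonneg_right (le_abs_self _) (hw j).le).trans (hle j)
  · refine main (-x) (fun i => by simp [hν]) (by simpa [← h] using habs) fun j => ?_
    simp only [Pi.neg_apply, ← h]
    exact (div_le_div_of_nonneg_right (neg_le_abs _) (hw j).le).trans (hle j)

/-- A linear map symmetric for the weighted inner product `∑ m x y` has an eigenvector that is not
orthogonal to `w` and whose eigenvalue is at least any lower bound of the Rayleigh quotient
of `w`. -/
theorem exists_eigenvector_of_le_rayleigh {ι : Type*} [Fintype ι]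
    (T : (ι → ℝ) →ₗ[ℝ] (ι → ℝ)) {m : ι → ℝ} (hm : ∀ i, 0 < m i)
    (hT : ∀ x y : ι → ℝ, ∑ i, m i * (T x i * y i) = ∑ i, m i * (x i * T y i))
    {w : ι → ℝ} (hw : w ≠ 0) {c : ℝ}
    (hc : c * ∑ i, m i * (w i * w i) ≤ ∑ i, m i * (w i * T w i)) :
    ∃ (ν : ℝ) (x : ι → ℝ), (∀ i, T x i = ν * x i) ∧ ∑ i, m i * (x i * w i) ≠ 0 ∧ c ≤ ν := by
  have hs : ∀ i, √(m i) ≠ 0 := fun i => (Real.sqrt_pos.mpr (hm i)).ne'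
  let D : (ι → ℝ) ≃ₗ[ℝ] EuclideanSpace ℝ ι :=
    { toFun := fun x => WithLp.toLp 2 fun i => √(m i) * x i
      invFun := fun y i => (√(m i))⁻¹ * y i
      map_add' := fun x y => by ext i; simp [mul_add]
      map_smul' := fun r x => by ext i; simp; ring
      left_inv := fun x => by ext i; simp [hs i]
      right_inv := fun y => by ext i; simp [hs i] }
  have hD : ∀ x y, inner ℝ (D x) (D y) = ∑ i, m i * (x i * y i) := fun x y => by
    simp only [D, PiLp.inner_apply, LinearEquiv.coe_mk, LinearMap.coe_mk, AddHom.coe_mk]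
    refine sum_congr rfl fun i _ => ?_
    rw [real_inner_eq_re_inner]
    simp only [RCLike.inner_apply, conj_trivial, RCLike.re_to_real]
    linear_combination (x i * y i) * Real.mul_self_sqrt (hm i).le
  let B : EuclideanSpace ℝ ι →ₗ[ℝ] EuclideanSpace ℝ ι := D.toLinearMap ∘ₗ T ∘ₗ D.symm.toLinearMap
  have hBD : ∀ x, B (D x) = D (T x) := fun x => by simp [B]
  have hB : B.IsSymmetric := fun x y => by
    obtain ⟨x, rfl⟩ := D.surjective x
    obtain ⟨y, rfl⟩ := D.surjective y
    rw [hBD, hBD, hD, hD, hT]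
  let b := hB.eigenvectorBasis rfl
  let e := hB.eigenvalues rfl
  have hb : ∀ k, B (b k) = e k • b k := fun k => hB.apply_eigenvectorBasis rfl k
  have hsum : ∀ y, ∑ k, inner ℝ (D w) (b k) * inner ℝ (b k) y = inner ℝ (D w) y :=
    fun y => b.sum_inner_mul_inner (D w) y
  have hBw : ∀ k, inner ℝ (b k) (B (D w)) = e k * inner ℝ (D w) (b k) := fun k => by
    rw [← hB, hb, real_inner_smul_left, real_inner_comm]
  have key : 0 ≤ ∑ k, (e k - c) * inner ℝ (D w) (b k) ^ 2 := by
    have h1 := hsum (B (D w))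
    have h2 := hsum (D w)
    rw [hBD, hD, ← hBD] at h1
    rw [hD] at h2
    rw [← h1, ← h2, mul_sum] at hc
    rw [← sub_nonneg, ← sum_sub_distrib] at hc
    refine hc.trans_eq (sum_congr rfl fun k _ => ?_)
    rw [hBw, real_inner_comm (D w) (b k)]
    ring
  have hex : ∃ k, inner ℝ (D w) (b k) ≠ 0 ∧ c ≤ e k := by
    by_contra! hcon
    have hnp : ∀ k ∈ univ, (e k - c) * inner ℝ (D w) (b k) ^ 2 ≤ 0 := fun k _ => by
      by_cases h : inner ℝ (D w) (b k) = 0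
      · simp [h]
      · exact mul_nonpos_of_nonpos_of_nonneg (by linarith [hcon k h]) (sq_nonneg _)
    have hz := (sum_eq_zero_iff_of_nonpos hnp).mp (le_antisymm (sum_nonpos hnp) key)
    have hz' : ∀ k, inner ℝ (D w) (b k) = 0 := fun k => by
      by_contra h
      have := hz k (mem_univ k)
      have h2 := hcon k h
      rcases mul_eq_zero.mp this with h3 | h3
      · linarith
      · exact h (pow_eq_zero_iff two_ne_zero |>.mp h3)
    have := hsum (D w)
    simp only [hz', zero_mul, sum_const_zero] at this
    exact hw (by simpa using (inner_self_eq_zero (𝕜 := ℝ)).mp this.symm)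
  obtain ⟨k, hk, hck⟩ := hex
  obtain ⟨x, hx⟩ := D.surjective (b k)
  refine ⟨e k, x, fun i => ?_, ?_, hck⟩
  · have := hb k
    rw [← hx, hBD, ← map_smul] at this
    simpa using congrFun (D.injective this) i
  · rwa [← hD, hx, real_inner_comm]

/-- Second-order expansion of the top eigenvalue `ν θ` of `T - θ V`, where `T` is a Markov
generator reversible with respect to `m`, `V` is a multiplication operator, and `w₁`, `w₂` solve the
first and second-order corrector equations. -/
theorem top_eigenvalue_expansion {ι : Type*} [Fintype ι] [Nonempty ι]
    (T : (ι → ℝ) →ₗ[ℝ] (ι → ℝ)) {m : ι → ℝ} (hm : ∀ i, 0 < m i)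
    (hsymm : ∀ x y : ι → ℝ, ∑ i, m i * (T x i * y i) = ∑ i, m i * (x i * T y i))
    (hpos : ∀ (i : ι) (y : ι → ℝ), (∀ j, 0 ≤ y j) → y i = 0 → 0 ≤ T y i)
    {V w₁ w₂ : ι → ℝ} {c e : ℝ} (hone : ∀ i, T (fun _ => 1) i = 0)
    (hw₁ : ∀ i, T w₁ i = V i - c) (hw₂ : ∀ i, T w₂ i = (V i - c) * w₁ i + e)
    {ν : ℝ → ℝ}
    (heig : ∀ θ, ∃ x : ι → ℝ, x ≠ 0 ∧ ∀ i, T x i - θ * (V i * x i) = ν θ * x i)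
    (htop : ∀ θ ν' (x : ι → ℝ), (∀ i, T x i - θ * (V i * x i) = ν' * x i) →
      ∑ i, m i * (x i * (1 + θ * w₁ i + θ ^ 2 * w₂ i)) ≠ 0 → ν' ≤ ν θ) :
    (fun θ => ν θ + θ * c - θ ^ 2 * e) =O[nhds 0] fun θ => θ ^ 3 := by
  let w : ℝ → ι → ℝ := fun θ i => 1 + θ * w₁ i + θ ^ 2 * w₂ i
  let r : ℝ → ι → ℝ := fun θ i => (c - V i) * w₂ i - e * w₁ i - θ * e * w₂ i
  let A : ℝ → (ι → ℝ) →ₗ[ℝ] (ι → ℝ) := fun θ => T - θ • LinearMap.mulLeft ℝ V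
  have hA : ∀ θ x i, A θ x i = T x i - θ * (V i * x i) := fun θ x i => by simp [A]
  have hAw : ∀ θ i, A θ (w θ) i = (-θ * c + θ ^ 2 * e) * w θ i + θ ^ 3 * r θ i := fun θ i => by
    have hw : w θ = (fun _ => 1) + θ • w₁ + θ ^ 2 • w₂ := by ext; simp [w]
    have hTw : T (w θ) i = θ * (V i - c) + θ ^ 2 * ((V i - c) * w₁ i + e) := by
      rw [hw]
      simp only [map_add, map_smul, Pi.add_apply, Pi.smul_apply, smul_eq_mul, hone, hw₁, hw₂]
      ring
    rw [hA, hTw]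
    simp only [w, r]
    ring
  obtain ⟨C, hC⟩ : ∃ C : ℝ, ∀ i, |(c - V i) * w₂ i - e * w₁ i| < C := by
    obtain ⟨C, hC⟩ := (Set.finite_range fun i => |(c - V i) * w₂ i - e * w₁ i|).bddAbove
    exact ⟨C + 1, fun i => (hC ⟨i, rfl⟩).trans_lt (lt_add_one C)⟩
  have hr : ∀ᶠ θ in nhds (0 : ℝ), ∀ i, |r θ i| < C := by
    refine Filter.eventually_all.mpr fun i => ?_
    have : Filter.Tendsto (fun θ => |r θ i|) (nhds 0) (nhds |r 0 i|) :=
      Continuous.tendsto (by fun_prop) 0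
    exact this.eventually_lt_const (by simpa [r] using hC i)
  have hw : ∀ᶠ θ in nhds (0 : ℝ), ∀ i, 1 / 2 < w θ i := by
    refine Filter.eventually_all.mpr fun i => ?_
    have : Filter.Tendsto (fun θ => w θ i) (nhds 0) (nhds (w 0 i)) :=
      Continuous.tendsto (by fun_prop) 0
    exact this.eventually_const_lt (by norm_num [w])
  refine Asymptotics.IsBigO.of_bound (2 * C) ?_
  filter_upwards [hr, hw] with θ hr hw
  set ε := 2 * C * |θ ^ 3| with hε
  have hres : ∀ i, |θ ^ 3 * r θ i| ≤ ε * w θ i := fun i => by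
    rw [abs_mul]
    have h1 : |θ ^ 3| * |r θ i| ≤ |θ ^ 3| * C := by gcongr; exact (hr i).le
    have hCpos : 0 ≤ C := (abs_nonneg _).trans (hr i).le
    have h2 : ε * (1 / 2) ≤ ε * w θ i := by gcongr; exact (hw i).le
    linarith
  have hwpos : ∀ i, 0 < w θ i := fun i => by linarith [hw i]
  have upper : ν θ ≤ -θ * c + θ ^ 2 * e + ε := by
    obtain ⟨x, hx0, hx⟩ := heig θ
    refine eigenvalue_le_of_supersolution (A θ) (fun i y hy hyi => ?_) hwpos (fun i => ?_) hx0
      (fun i => by rw [hA, hx])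
    · rw [hA, hyi]
      simpa using hpos i y hy hyi
    · rw [hAw]
      linarith [(abs_le.mp (hres i)).2]
  have lower : -θ * c + θ ^ 2 * e - ε ≤ ν θ := by
    obtain ⟨ν', x, hx, hxw, hν'⟩ := exists_eigenvector_of_le_rayleigh (A θ) hm (w := w θ)
      (c := -θ * c + θ ^ 2 * e - ε) (fun x y => by
        simp only [hA, sub_mul, mul_sub, sum_sub_distrib, hsymm]
        congr 1
        exact sum_congr rfl fun i _ => by ring)
      (fun h => by
        obtain ⟨i⟩ := ‹Nonempty ι›
        exact (hwpos i).ne' (congrFun h i))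
      (by
        rw [mul_sum]
        refine sum_le_sum fun i _ => ?_
        rw [hAw]
        have h1 := mul_le_mul_of_nonneg_left (neg_le_of_abs_le (hres i))
          (mul_pos (hm i) (hwpos i)).le
        linarith)
    exact hν'.trans (htop θ ν' x (fun i => by rw [← hA, hx]) hxw)
  rw [Real.norm_eq_abs, Real.norm_eq_abs, abs_le]
  constructor <;> linarith

/-- The generator of the random walk with rate `g` on the complete graph. -/
def completeWalk {N : ℕ} (g : ℝ) : (Fin N → ℝ) →ₗ[ℝ] (Fin N → ℝ) where
  toFun x j := g * ∑ n, (x n - x j)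
  map_add' x y := by
    ext j
    simp only [Pi.add_apply, ← mul_add, ← sum_add_distrib]
    congr 1
    exact sum_congr rfl fun n _ => by ring
  map_smul' r x := by
    ext j
    simp only [Pi.smul_apply, smul_eq_mul, RingHom.id_apply, mul_sum]
    exact sum_congr rfl fun n _ => by ring

/-- The second-moment operator `Theta` for the constant coupling `g`, on arrays indexed by pairs. -/
def constTheta {N : ℕ} (g : ℝ) : (Fin N × Fin N → ℝ) →ₗ[ℝ] (Fin N × Fin N → ℝ) where
  toFun x p := g * ∑ n, (x (p.1, n) + x (n, p.2) - 2 * x p)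
    + g * (x (p.1, p.1) + x (p.2, p.2) - 2 * x p)
  map_add' x y := by
    ext p
    have : ∑ n, (x (p.1, n) + y (p.1, n) + (x (n, p.2) + y (n, p.2)) - 2 * (x p + y p))
        = ∑ n, (x (p.1, n) + x (n, p.2) - 2 * x p)
          + ∑ n, (y (p.1, n) + y (n, p.2) - 2 * y p) := by
      rw [← sum_add_distrib]
      exact sum_congr rfl fun n _ => by ring
    simp only [Pi.add_apply, this]
    ring
  map_smul' r x := by
    ext p
    have : ∑ n, (r * x (p.1, n) + r * x (n, p.2) - 2 * (r * x p))
        = r * ∑ n, (x (p.1, n) + x (n, p.2) - 2 * x p) := by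
      rw [mul_sum]
      exact sum_congr rfl fun n _ => by ring
    simp only [Pi.smul_apply, smul_eq_mul, RingHom.id_apply, this]
    ring

theorem completeWalk_apply {N : ℕ} (g : ℝ) (x : Fin N → ℝ) (j : Fin N) :
    completeWalk g x j = g * ∑ n, (x n - x j) := rfl

theorem constTheta_apply {N : ℕ} (g : ℝ) (x : Fin N × Fin N → ℝ) (j l : Fin N) :
    constTheta g x (j, l) = g * ∑ n, (x (j, n) + x (n, l) - 2 * x (j, l))
      + g * (x (j, j) + x (l, l) - 2 * x (j, l)) := rfl

theorem mulVec_eq_completeWalk {N : ℕ} {g : ℝ} {Γ : Matrix (Fin N) (Fin N) ℝ}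
    (hΓ : ∀ j l : Fin N, Γ j l = if j = l then -((N : ℝ) - 1) * g else g)
    (x : Fin N → ℝ) (j : Fin N) : Γ.mulVec x j = completeWalk g x j := by
  have h : ∀ n, Γ j n * x n = g * x n - if j = n then N * g * x n else 0 := fun n => by
    rw [hΓ]
    split_ifs <;> ring
  simp only [mulVec, dotProduct, h, completeWalk_apply, sum_sub_distrib, sum_ite_eq, mem_univ,
    if_true, ← mul_sum, sum_const, card_univ, Fintype.card_fin, nsmul_eq_mul]
  ring

theorem Theta_eq_constTheta {N : ℕ} {g : ℝ} {Γ : Matrix (Fin N) (Fin N) ℝ}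
    (hΓ : ∀ j l : Fin N, Γ j l = if j = l then -((N : ℝ) - 1) * g else g)
    (x : Fin N × Fin N → ℝ) (j l : Fin N) :
    Theta Γ (fun j l => x (j, l)) j l = constTheta g x (j, l) := by
  have h : ∀ n ∈ (univ.erase j).erase l,
      Γ l n * (x (j, n) - x (j, l)) + Γ j n * (x (n, l) - x (j, l))
        = g * (x (j, n) + x (n, l) - 2 * x (j, l)) := fun n hn => by
    simp only [mem_erase, mem_univ, and_true] at hn
    rw [hΓ, hΓ, if_neg (Ne.symm hn.1), if_neg (Ne.symm hn.2)]
    ring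
  rw [Theta, sum_congr rfl h, ← mul_sum, constTheta_apply]
  have hj := sum_erase_eq_sub (f := fun n => x (j, n) + x (n, l) - 2 * x (j, l)) (mem_univ j)
  by_cases hjl : j = l
  · subst hjl
    rw [erase_idem, hj, if_neg (by simp)]
    ring
  · have hl := sum_erase_eq_sub (f := fun n => x (j, n) + x (n, l) - 2 * x (j, l))
      (mem_erase.mpr ⟨Ne.symm hjl, mem_univ l⟩)
    rw [hl, hj, if_pos hjl, hΓ, if_neg hjl]
    ring

theorem completeWalk_symm {N : ℕ} (g : ℝ) (x y : Fin N → ℝ) :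
    ∑ i, 1 * (completeWalk g x i * y i) = ∑ i, 1 * (x i * completeWalk g y i) := by
  simp only [completeWalk_apply, one_mul, sum_sub_distrib, mul_sub, sub_mul, sum_const,
    nsmul_eq_mul]
  congr 1
  · simp only [← sum_mul, ← mul_sum]
    ring
  · exact sum_congr rfl fun i _ => by ring

/-- The reversible weight of `constTheta`. -/
def pairWeight {N : ℕ} (p : Fin N × Fin N) : ℝ := 1 + if p.1 = p.2 then 1 else 0

theorem pairWeight_pos {N : ℕ} (p : Fin N × Fin N) : 0 < pairWeight p := by
  unfold pairWeight
  split_ifs <;> norm_num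

theorem sum_pairWeight {N : ℕ} (f : Fin N × Fin N → ℝ) :
    ∑ p, pairWeight p * f p = ∑ j, ∑ l, f (j, l) + ∑ j, f (j, j) := by
  simp [pairWeight, Fintype.sum_prod_type, add_mul, sum_add_distrib]

theorem constTheta_symm {N : ℕ} (g : ℝ) (x y : Fin N × Fin N → ℝ) :
    ∑ p, pairWeight p * (constTheta g x p * y p)
      = ∑ p, pairWeight p * (x p * constTheta g y p) := by
  have h₁ : ∑ j, ∑ l, (∑ n, x (j, n)) * y (j, l) = ∑ j, ∑ l, x (j, l) * ∑ n, y (j, n) :=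
    sum_congr rfl fun j _ => by rw [← mul_sum, ← sum_mul]
  have h₂ : ∑ j, ∑ l, (∑ n, x (n, l)) * y (j, l) = ∑ j, ∑ l, x (j, l) * ∑ n, y (n, l) := by
    rw [sum_comm, sum_comm (f := fun j l => x (j, l) * ∑ n, y (n, l))]
    exact sum_congr rfl fun l _ => by rw [← mul_sum, ← sum_mul]
  have hl : ∀ x y : Fin N × Fin N → ℝ,
      ∑ j, ∑ l, x (j, j) * y (j, l) = ∑ j, x (j, j) * ∑ n, y (j, n) := fun x y =>
    sum_congr rfl fun j _ => by rw [mul_sum]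
  have hr : ∀ x y : Fin N × Fin N → ℝ,
      ∑ j, ∑ l, x (l, l) * y (j, l) = ∑ j, x (j, j) * ∑ n, y (n, j) := fun x y => by
    rw [sum_comm]
    exact sum_congr rfl fun j _ => by rw [mul_sum]
  have formula : ∀ x y : Fin N × Fin N → ℝ, ∑ p, pairWeight p * (constTheta g x p * y p)
      = g * (∑ j, ∑ l, (∑ n, x (j, n)) * y (j, l) + ∑ j, ∑ l, (∑ n, x (n, l)) * y (j, l)
        - (2 * N + 2) * ∑ j, ∑ l, x (j, l) * y (j, l)
        + (∑ j, x (j, j) * ∑ n, y (j, n) + ∑ j, x (j, j) * ∑ n, y (n, j)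
          + ∑ j, y (j, j) * ∑ n, x (j, n) + ∑ j, y (j, j) * ∑ n, x (n, j))
        - 2 * N * ∑ j, x (j, j) * y (j, j)) := fun x y => by
    rw [sum_pairWeight, ← hl x y, ← hr x y]
    simp only [constTheta_apply, sum_add_distrib, sum_sub_distrib, sum_const, card_univ,
      Fintype.card_fin, nsmul_eq_mul]
    have e₁ : ∀ j l, (g * (∑ n, x (j, n) + ∑ n, x (n, l) - N * (2 * x (j, l)))
        + g * (x (j, j) + x (l, l) - 2 * x (j, l))) * y (j, l)
        = g * ((∑ n, x (j, n)) * y (j, l) + (∑ n, x (n, l)) * y (j, l)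
          - (2 * N + 2) * (x (j, l) * y (j, l)) + x (j, j) * y (j, l) + x (l, l) * y (j, l)) :=
      fun j l => by ring
    have e₂ : ∀ j, (g * (∑ n, x (j, n) + ∑ n, x (n, j) - N * (2 * x (j, j)))
        + g * (x (j, j) + x (j, j) - 2 * x (j, j))) * y (j, j)
        = g * (y (j, j) * ∑ n, x (j, n) + y (j, j) * ∑ n, x (n, j)
          - 2 * N * (x (j, j) * y (j, j))) :=
      fun j => by ring
    simp only [e₂]
    simp only [e₁, ← mul_sum, sum_add_distrib, sum_sub_distrib]
    ring
  have hswap : ∑ p, pairWeight p * (x p * constTheta g y p)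
      = ∑ p, pairWeight p * (constTheta g y p * x p) :=
    sum_congr rfl fun p _ => by ring
  have hc : ∀ f h : Fin N → Fin N → ℝ, ∑ j, ∑ l, f j l * h j l = ∑ j, ∑ l, h j l * f j l :=
    fun f h => sum_congr rfl fun j _ => sum_congr rfl fun l _ => mul_comm _ _
  have hd : ∑ j, y (j, j) * x (j, j) = ∑ j, x (j, j) * y (j, j) :=
    sum_congr rfl fun j _ => mul_comm _ _
  rw [hswap, formula, formula, h₁, h₂, hc (fun j l => x (j, l)) (fun j l => ∑ n, y (j, n)),
    hc (fun j l => x (j, l)) (fun j l => ∑ n, y (n, l)),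
    hc (fun j l => x (j, l)) (fun j l => y (j, l)), hd]
  ring

theorem completeWalk_nonneg {N : ℕ} {g : ℝ} (hg : 0 < g) (j : Fin N) (y : Fin N → ℝ)
    (hy : ∀ i, 0 ≤ y i) (hj : y j = 0) : 0 ≤ completeWalk g y j := by
  rw [completeWalk_apply, hj]
  exact mul_nonneg hg.le (sum_nonneg fun n _ => by simpa using hy n)

theorem constTheta_nonneg {N : ℕ} {g : ℝ} (hg : 0 < g) (p : Fin N × Fin N)
    (y : Fin N × Fin N → ℝ) (hy : ∀ i, 0 ≤ y i) (hp : y p = 0) : 0 ≤ constTheta g y p := by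
  obtain ⟨j, l⟩ := p
  rw [constTheta_apply, hp]
  refine add_nonneg (mul_nonneg hg.le (sum_nonneg fun n _ => ?_)) (mul_nonneg hg.le ?_) <;>
    linarith [hy (j, j), hy (l, l), hy (j, ‹Fin N›), hy (‹Fin N›, l)]

theorem isBigO_lam {N : ℕ} (hN : 0 < N) {g : ℝ} (hg : 0 < g)
    {Γ : Matrix (Fin N) (Fin N) ℝ}
    (hΓ : ∀ j l : Fin N, Γ j l = if j = l then -((N : ℝ) - 1) * g else g)
    {Λ : Fin N → ℝ} {lam1 : ℝ} (hlam1 : lam1 = (∑ j, Λ j) / N) {lam : ℝ → ℝ}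
    (hlam_eig : ∀ θ : ℝ, ∃ v : Fin N → ℝ, v ≠ 0 ∧
      (Γ - θ • Matrix.diagonal Λ).mulVec v = (-lam θ) • v)
    (hlam_top : ∀ θ : ℝ, ∀ μ' : ℝ,
      (∃ v : Fin N → ℝ, v ≠ 0 ∧ (Γ - θ • Matrix.diagonal Λ).mulVec v = μ' • v) →
      μ' ≤ -lam θ) :
    (fun θ => -lam θ + θ * lam1 - θ ^ 2 * ((∑ j, (Λ j - lam1) ^ 2) / (N ^ 2 * g)))
      =O[nhds 0] fun θ => θ ^ 3 := by
  have hN0 : (N : ℝ) ≠ 0 := by positivity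
  have : Nonempty (Fin N) := ⟨⟨0, hN⟩⟩
  have hsum : ∑ j, Λ j = N * lam1 := by rw [hlam1]; field_simp
  have hmul : ∀ θ (v : Fin N → ℝ) j, (Γ - θ • Matrix.diagonal Λ).mulVec v j
      = completeWalk g v j - θ * (Λ j * v j) := fun θ v j => by
    rw [sub_mulVec, smul_mulVec, Pi.sub_apply, mulVec_eq_completeWalk hΓ]
    simp [mulVec_diagonal]
  set q := ∑ j, (Λ j - lam1) ^ 2 with hq
  refine top_eigenvalue_expansion (completeWalk g) (m := fun _ => 1) (fun _ => one_pos)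
    (completeWalk_symm g) (completeWalk_nonneg hg) (V := Λ)
    (w₁ := fun j => -(Λ j - lam1) / (N * g))
    (w₂ := fun j => ((Λ j - lam1) ^ 2 - q / N) / (N * g) ^ 2) ?_ ?_ ?_ ?_ ?_
  · intro j
    simp [completeWalk_apply]
  · intro j
    rw [completeWalk_apply, sum_sub_distrib, ← sum_div, sum_neg_distrib, sum_sub_distrib, hsum]
    simp only [sum_const, card_univ, Fintype.card_fin, nsmul_eq_mul]
    field_simp
    ring
  · intro j
    rw [completeWalk_apply, sum_sub_distrib, ← sum_div, sum_sub_distrib, ← hq]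
    simp only [sum_const, card_univ, Fintype.card_fin, nsmul_eq_mul]
    field_simp
    ring
  · intro θ
    obtain ⟨v, hv, h⟩ := hlam_eig θ
    exact ⟨v, hv, fun j => by rw [← hmul, h]; simp⟩
  · intro θ ν' v hv hne
    refine hlam_top θ ν' ⟨v, fun h => hne (by simp [h]), ?_⟩
    ext j
    rw [hmul, hv]
    simp

theorem isBigO_mu {N : ℕ} (hN : 0 < N) {g : ℝ} (hg : 0 < g)
    {Γ : Matrix (Fin N) (Fin N) ℝ}
    (hΓ : ∀ j l : Fin N, Γ j l = if j = l then -((N : ℝ) - 1) * g else g)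
    {Λ : Fin N → ℝ} {lam1 : ℝ} (hlam1 : lam1 = (∑ j, Λ j) / N) {mu : ℝ → ℝ}
    (hmu_eig : ∀ θ : ℝ, ∃ S : Fin N → Fin N → ℝ, S ≠ 0 ∧ (∀ j l, S j l = S l j) ∧
      (fun j l => Theta Γ S j l - θ * Psi Λ S j l) = fun j l => (-mu θ) * S j l)
    (hmu_top : ∀ θ : ℝ, ∀ μ' : ℝ,
      (∃ S : Fin N → Fin N → ℝ, S ≠ 0 ∧ (∀ j l, S j l = S l j) ∧
        (fun j l => Theta Γ S j l - θ * Psi Λ S j l) = fun j l => μ' * S j l) →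
      μ' ≤ -mu θ) :
    (fun θ => -mu θ + θ * (2 * lam1)
        - θ ^ 2 * (2 * (N + 2) * (∑ j, (Λ j - lam1) ^ 2) / (N ^ 2 * (N + 1) * g)))
      =O[nhds 0] fun θ => θ ^ 3 := by
  have hN0 : (N : ℝ) ≠ 0 := by positivity
  have hN1 : (N : ℝ) + 1 ≠ 0 := by positivity
  have : Nonempty (Fin N) := ⟨⟨0, hN⟩⟩
  have hsum : ∑ j, (Λ j - lam1) = 0 := by
    rw [hlam1]
    simp only [sum_sub_distrib, sum_const, card_univ, Fintype.card_fin, nsmul_eq_mul]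
    field_simp
    ring
  set a : Fin N → ℝ := fun j => Λ j - lam1 with ha
  have hsum' : ∑ j, a j = 0 := hsum
  set q := ∑ j, a j ^ 2 with hq
  refine top_eigenvalue_expansion (constTheta g) pairWeight_pos
    (constTheta_symm g) (constTheta_nonneg hg) (V := fun p => Λ p.1 + Λ p.2)
    (w₁ := fun p => -(a p.1 + a p.2) / (N * g))
    (w₂ := fun p => (N + 2) / ((N + 1) * (N * g) ^ 2) * (a p.1 ^ 2 + a p.2 ^ 2 - 2 * (q / N))
      + a p.1 * a p.2 / ((N + 1) * N * g ^ 2)) ?_ ?_ ?_ ?_ ?_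
  · rintro ⟨j, l⟩
    rw [constTheta_apply]
    norm_num
  · rintro ⟨j, l⟩
    simp only [constTheta_apply, sum_sub_distrib, sum_add_distrib, ← sum_div, sum_neg_distrib,
      hsum', sum_const, card_univ, Fintype.card_fin, nsmul_eq_mul]
    field_simp
    simp only [ha]
    ring
  · rintro ⟨j, l⟩
    have hV : Λ j + Λ l - 2 * lam1 = a j + a l := by simp only [ha]; ring
    simp only [constTheta_apply, sum_sub_distrib, sum_add_distrib, ← sum_div, ← mul_sum, ← sum_mul,
      hsum', ← hq, sum_const, card_univ, Fintype.card_fin, nsmul_eq_mul, hV]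
    field_simp
    ring
  · intro θ
    obtain ⟨S, hS, -, h⟩ := hmu_eig θ
    refine ⟨fun p => S p.1 p.2, fun h0 => hS ?_, ?_⟩
    · ext j l
      exact congrFun h0 (j, l)
    · rintro ⟨j, l⟩
      rw [← Theta_eq_constTheta hΓ]
      exact congrFun (congrFun h j) l
  · intro θ ν' x hx hne
    let y : Fin N × Fin N → ℝ := fun p => x p + x p.swap
    have hswap : ∀ p : Fin N × Fin N,
        constTheta g (fun p => x p.swap) p = constTheta g x p.swap := by
      rintro ⟨j, l⟩
      simp only [constTheta_apply, Prod.swap_prod_mk]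
      congr 2
      · exact sum_congr rfl fun n _ => by ring
      · ring
    refine hmu_top θ ν' ⟨fun j l => y (j, l), fun h0 => hne ?_, fun j l => ?_, ?_⟩
    · have hanti : ∀ p, x p.swap = -x p := by
        rintro ⟨j, l⟩
        have := congrFun (congrFun h0 j) l
        simp only [y, Pi.zero_apply] at this
        linarith
      set F : Fin N × Fin N → ℝ := _
      change ∑ p, F p = 0
      have h1 : ∑ p, F p = ∑ p : Fin N × Fin N, F p.swap :=
        ((Equiv.prodComm _ _).sum_comp F).symm
      have h2 : ∀ p : Fin N × Fin N, F p.swap = -F p := fun p => by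
        simp only [F, hanti, pairWeight, Prod.fst_swap, Prod.snd_swap, eq_comm (a := p.2)]
        ring
      simp only [h2, sum_neg_distrib] at h1
      linarith
    · simp only [y, Prod.swap_prod_mk]
      ring
    · ext j l
      have hy : y = x + fun p => x p.swap := rfl
      rw [Theta_eq_constTheta hΓ, hy, map_add, Pi.add_apply, hswap]
      have h1 := hx (j, l)
      have h2 := hx (l, j)
      simp only [Psi, Pi.add_apply, Prod.swap_prod_mk] at h1 h2 ⊢
      linarith

/-- equal coupling `Γ_{jl} ≡ Γ > 0` and weak dissipation
`Λ_j = θ Λ¹_j`: the growth-rate difference satisfies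
`μ - 2λ = -(2θ²/(N²(N+1)Γ)) ∑_j (Λ¹_j - λ¹)² + O(θ³)`, and in particular
`μ - 2λ < 0` for small `θ > 0` as soon as the `Λ¹_j` are not all equal. -/
theorem stmt10 {N : ℕ} (hN : 2 ≤ N) (g : ℝ) (hg : 0 < g)
    (Γ : Matrix (Fin N) (Fin N) ℝ)
    (hΓ : ∀ j l : Fin N, Γ j l = if j = l then -((N : ℝ) - 1) * g else g)
    (Λ : Fin N → ℝ) (lam1 : ℝ) (hlam1 : lam1 = (∑ j, Λ j) / N)
    (lam mu : ℝ → ℝ)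
    (hlam_eig : ∀ θ : ℝ, ∃ v : Fin N → ℝ, v ≠ 0 ∧
      (Γ - θ • Matrix.diagonal Λ).mulVec v = (-lam θ) • v)
    (hlam_top : ∀ θ : ℝ, ∀ μ' : ℝ,
      (∃ v : Fin N → ℝ, v ≠ 0 ∧ (Γ - θ • Matrix.diagonal Λ).mulVec v = μ' • v) →
      μ' ≤ -lam θ)
    (hmu_eig : ∀ θ : ℝ, ∃ S : Fin N → Fin N → ℝ, S ≠ 0 ∧ (∀ j l, S j l = S l j) ∧
      (fun j l => Theta Γ S j l - θ * Psi Λ S j l) = fun j l => (-mu θ) * S j l)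
    (hmu_top : ∀ θ : ℝ, ∀ μ' : ℝ,
      (∃ S : Fin N → Fin N → ℝ, S ≠ 0 ∧ (∀ j l, S j l = S l j) ∧
        (fun j l => Theta Γ S j l - θ * Psi Λ S j l) = fun j l => μ' * S j l) →
      μ' ≤ -mu θ) :
    ((fun θ : ℝ => mu θ - 2 * lam θ
        + (2 * θ ^ 2 / ((N : ℝ) ^ 2 * ((N : ℝ) + 1) * g)) * ∑ j, (Λ j - lam1) ^ 2)
      =O[nhds 0] (fun θ : ℝ => θ ^ 3))
    ∧ ((∃ j j' : Fin N, Λ j ≠ Λ j') →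
        ∃ θ0 > (0 : ℝ), ∀ θ : ℝ, 0 < θ → θ < θ0 → mu θ - 2 * lam θ < 0) := by
  have hN' : 0 < N := by omega
  have hN0 : (N : ℝ) ≠ 0 := by positivity
  have hN1 : (N : ℝ) + 1 ≠ 0 := by positivity
  have hO := ((isBigO_lam hN' hg hΓ hlam1 hlam_eig hlam_top).const_mul_left 2).sub
    (isBigO_mu hN' hg hΓ hlam1 hmu_eig hmu_top)
  have hmain : (fun θ : ℝ => mu θ - 2 * lam θ
      + (2 * θ ^ 2 / ((N : ℝ) ^ 2 * ((N : ℝ) + 1) * g)) * ∑ j, (Λ j - lam1) ^ 2)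
      =O[nhds 0] (fun θ : ℝ => θ ^ 3) := by
    refine hO.congr_left fun θ => ?_
    field_simp
    ring
  refine ⟨hmain, fun ⟨j, j', hjj'⟩ => ?_⟩
  have hq : 0 < ∑ j, (Λ j - lam1) ^ 2 := by
    refine (sum_nonneg fun _ _ => sq_nonneg _).lt_of_ne' fun h => hjj' ?_
    have hz := (sum_eq_zero_iff_of_nonneg fun _ _ => sq_nonneg _).mp h
    have h1 := pow_eq_zero_iff two_ne_zero |>.mp (hz j (mem_univ j))
    have h2 := pow_eq_zero_iff two_ne_zero |>.mp (hz j' (mem_univ j'))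
    linarith
  set K := 2 / ((N : ℝ) ^ 2 * ((N : ℝ) + 1) * g) * ∑ j, (Λ j - lam1) ^ 2 with hK
  have hKpos : 0 < K := by positivity
  obtain ⟨C, hC, hbound⟩ := hmain.exists_pos
  obtain ⟨δ, hδ, hball⟩ := Metric.eventually_nhds_iff.mp hbound.bound
  refine ⟨min δ (K / C), by positivity, fun θ hθ hlt => ?_⟩
  have h1 := hball (y := θ) (by
    rw [Real.dist_eq, sub_zero, abs_of_pos hθ]
    exact hlt.trans_le (min_le_left _ _))
  rw [Real.norm_eq_abs, Real.norm_eq_abs, abs_of_pos (pow_pos hθ 3)] at h1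
  have h2 := (abs_le.mp h1).2
  have h3 : C * θ < K := by
    have := (lt_div_iff₀ hC).mp (hlt.trans_le (min_le_right _ _))
    linarith
  have h4 : 2 * θ ^ 2 / ((N : ℝ) ^ 2 * ((N : ℝ) + 1) * g) * ∑ j, (Λ j - lam1) ^ 2
      = θ ^ 2 * K := by
    rw [hK]
    ring
  have h5 := mul_lt_mul_of_pos_left h3 (pow_pos hθ 2)
  rw [h4] at h2
  linarith
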